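/- Let n ≥ 1, let Q be an n×n real symmetric positive definite matrix, let a_1, a_2, a_3 ∈ ℝ, and let A be the 3n×3n block matrix with block rows (0, I_n, 0), (0, 0, I_n), (−a_1 Q, −a_2 Q, −a_3 Q). Then A is stable (every eigenvalue of A over ℂ has strictly negative real part) if and only if a_1 > 0, a_2 > 0, a_3 > 0, and a_2·a_3·λ > a_1 for every eigenvalue λ of Q. -/

import Mathlib

/-- Block matrix with `k × k` blocks, each an `n × n` real matrix. -/
def Mblk {k n : ℕ} (B : Fin k → Fin k → Matrix (Fin n) (Fin n) ℝ) :
    Matrix (Fin k × Fin n) (Fin k × Fin n) ℝ :=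
  Matrix.of fun x y => B x.1 y.1 x.2 y.2

/-- Every monic real cubic has a real root. -/
theorem exists_real_root_cubic (b c d : ℝ) : ∃ r : ℝ, r ^ 3 + b * r ^ 2 + c * r + d = 0 := by
  set M : ℝ := 1 + |b| + |c| + |d| with hM
  have hM1 : 1 ≤ M := by linarith [abs_nonneg b, abs_nonneg c, abs_nonneg d]
  have bound (e : ℝ) (k : ℕ) (hk : k ≤ 2) : |e * M ^ k| ≤ |e| * M ^ 2 := by
    rw [abs_mul, abs_of_nonneg (by positivity : 0 ≤ M ^ k)]
    gcongr
  have hb := abs_le.mp (bound b 2 le_rfl)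
  have hc := abs_le.mp (bound c 1 (by norm_num))
  have hd := abs_le.mp (bound d 0 (by norm_num))
  have hcube : M ^ 3 = M ^ 2 + |b| * M ^ 2 + |c| * M ^ 2 + |d| * M ^ 2 := by
    rw [pow_succ' M 2]
    nth_rewrite 1 [hM]
    ring
  have hsq : 0 < M ^ 2 := by positivity
  have hcont : ContinuousOn (fun r : ℝ => r ^ 3 + b * r ^ 2 + c * r + d) (Set.Icc (-M) M) := by
    fun_prop
  obtain ⟨r, -, hr⟩ := intermediate_value_Icc (by linarith) hcont
    (show (0 : ℝ) ∈ Set.Icc _ _ by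
      simp only [pow_one, pow_zero, mul_one] at hc hd
      constructor
      · linear_combination hb.2 + hc.1 + hd.2 + hsq.le - hcube
      · linear_combination hb.1 + hc.1 + hd.1 + hsq.le - hcube)
  exact ⟨r, hr⟩

/-- The Routh–Hurwitz conditions are sufficient for a real cubic. -/
theorem re_neg_of_cubic_root {b c d : ℝ} (hb : 0 < b) (hc : 0 < c) (hd : 0 < d)
    (hbc : d < b * c) {z : ℂ} (hz : z ^ 3 + b * z ^ 2 + c * z + d = 0) : z.re < 0 := by
  obtain ⟨x, y⟩ := z
  have hre := congrArg Complex.re hz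
  have him := congrArg Complex.im hz
  simp [pow_succ] at hre him
  by_contra! hx
  replace hx : 0 ≤ x := hx
  by_cases hy : y = 0
  · subst hy
    have : 0 < x * x * x + b * (x * x) + c * x + d := by positivity
    linarith
  · have hy2 : y ^ 2 = 3 * x ^ 2 + 2 * b * x + c := by
      apply mul_left_cancel₀ hy
      linear_combination -him
    have : 8 * x ^ 3 + 8 * b * x ^ 2 + (2 * c + 2 * b ^ 2) * x + (b * c - d) = 0 := by
      linear_combination -hre + (-3 * x - b) * hy2
    have : 0 ≤ 8 * x ^ 3 + 8 * b * x ^ 2 + (2 * c + 2 * b ^ 2) * x := by positivity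
    linarith

/-- A real monic quadratic with all roots in the open left half-plane has positive coefficients. -/
theorem quadratic_coeffs_pos {p q : ℝ}
    (h : ∀ z : ℂ, z ^ 2 + p * z + q = 0 → z.re < 0) : 0 < p ∧ 0 < q := by
  rcases le_or_gt 0 (p ^ 2 - 4 * q) with hD | hD
  · have hs := Real.sq_sqrt hD
    have hs0 := Real.sqrt_nonneg (p ^ 2 - 4 * q)
    set s := √(p ^ 2 - 4 * q)
    have key := h (((-p + s) / 2 : ℝ) : ℂ) (by
      norm_cast
      linear_combination hs / 4)
    rw [Complex.ofReal_re] at key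
    constructor <;> nlinarith
  · have hs := Real.sq_sqrt (neg_nonneg.mpr hD.le)
    set s := √(-(p ^ 2 - 4 * q))
    have key := h ⟨-p / 2, s / 2⟩ (by
      apply Complex.ext
      · simp [pow_succ]
        linear_combination -hs / 4
      · simp [pow_succ]
        ring)
    replace key : -p / 2 < 0 := key
    constructor <;> nlinarith

/-- Routh–Hurwitz criterion for real cubics. -/
theorem cubic_roots_re_neg_iff (b c d : ℝ) :
    (∀ z : ℂ, z ^ 3 + b * z ^ 2 + c * z + d = 0 → z.re < 0) ↔
      0 < b ∧ 0 < c ∧ 0 < d ∧ d < b * c := by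
  refine ⟨fun h => ?_, fun ⟨hb, hc, hd, hbc⟩ z hz => re_neg_of_cubic_root hb hc hd hbc hz⟩
  obtain ⟨r, hr⟩ := exists_real_root_cubic b c d
  have hr0 : r < 0 := by simpa using h r (by exact_mod_cast hr)
  obtain ⟨hp, hq⟩ := quadratic_coeffs_pos (p := b + r) (q := c + b * r + r ^ 2) fun z hz => by
    have hr' : (r : ℂ) ^ 3 + b * r ^ 2 + c * r + d = 0 := by exact_mod_cast hr
    apply h z
    push_cast at hz
    linear_combination (z - r) * hz + hr'
  have hd : d = -r * (c + b * r + r ^ 2) := by linear_combination hr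
  have hb : 0 < b := by linarith
  have hpr : 0 < -r * (b + r) := mul_pos (by linarith) hp
  refine ⟨hb, by nlinarith, hd ▸ mul_pos (by linarith) hq, ?_⟩
  nlinarith [mul_pos hp hq, mul_pos hpr hb]

/-- The roots of the characteristic polynomial are the `μ` possessing an eigenvector. -/
theorem mem_roots_charpoly_iff_exists_eigenvector {ι K : Type*} [Fintype ι] [DecidableEq ι]
    [Field K] (M : Matrix ι ι K) (μ : K) :
    μ ∈ M.charpoly.roots ↔ ∃ v : ι → K, v ≠ 0 ∧ M.mulVec v = μ • v := by
  rw [Polynomial.mem_roots M.charpoly_monic.ne_zero, Polynomial.IsRoot, Matrix.eval_charpoly,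
    ← Matrix.exists_mulVec_eq_zero_iff]
  simp [Matrix.sub_mulVec, sub_eq_zero, eq_comm]

/-- Eigenvectors of the third-order block matrix have the form `(x, μ x, μ² x)`. -/
theorem mem_roots_charpoly_thirdOrder_iff {n : ℕ} (Q : Matrix (Fin n) (Fin n) ℝ)
    (a₁ a₂ a₃ : ℝ) (μ : ℂ) :
    μ ∈ (((Mblk ![![0, 1, 0], ![0, 0, 1],
        ![-(a₁ • Q), -(a₂ • Q), -(a₃ • Q)]]).map Complex.ofReal).charpoly).roots ↔
      ∃ x : Fin n → ℂ, x ≠ 0 ∧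
        μ ^ 3 • x = -(a₁ + a₂ * μ + a₃ * μ ^ 2) • (Q.map Complex.ofReal).mulVec x := by
  rw [mem_roots_charpoly_iff_exists_eigenvector]
  set M := (Mblk ![![0, 1, 0], ![0, 0, 1],
    ![-(a₁ • Q), -(a₂ • Q), -(a₃ • Q)]]).map Complex.ofReal
  have hrows (v : Fin 3 × Fin n → ℂ) : M.mulVec v = μ • v ↔
      (∀ i, v (1, i) = μ * v (0, i)) ∧ (∀ i, v (2, i) = μ * v (1, i)) ∧
      ∀ i, -(a₁ * ∑ j, Q i j * v (0, j)) - a₂ * ∑ j, Q i j * v (1, j)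
        - a₃ * ∑ j, Q i j * v (2, j) = μ * v (2, i) := by
    have hone (i j : Fin n) (z : ℂ) :
        (((1 : Matrix (Fin n) (Fin n) ℝ) i j : ℝ) : ℂ) * z = if i = j then z else 0 := by
      rw [Matrix.one_apply]
      split_ifs <;> simp
    have h1 (i : Fin n) : (M.mulVec v) (0, i) = v (1, i) := by
      rw [Matrix.mulVec, dotProduct, Fintype.sum_prod_type, Fin.sum_univ_three]
      change ∑ j, ((0 : ℝ) : ℂ) * v (0, j)
        + ∑ j, (((1 : Matrix (Fin n) (Fin n) ℝ) i j : ℝ) : ℂ) * v (1, j)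
        + ∑ j, ((0 : ℝ) : ℂ) * v (2, j) = _
      simp [hone]
    have h2 (i : Fin n) : (M.mulVec v) (1, i) = v (2, i) := by
      rw [Matrix.mulVec, dotProduct, Fintype.sum_prod_type, Fin.sum_univ_three]
      change ∑ j, ((0 : ℝ) : ℂ) * v (0, j) + ∑ j, ((0 : ℝ) : ℂ) * v (1, j)
        + ∑ j, (((1 : Matrix (Fin n) (Fin n) ℝ) i j : ℝ) : ℂ) * v (2, j) = _
      simp [hone]
    have h3 (i : Fin n) : (M.mulVec v) (2, i) = -(a₁ * ∑ j, Q i j * v (0, j))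
        - a₂ * ∑ j, Q i j * v (1, j) - a₃ * ∑ j, Q i j * v (2, j) := by
      rw [Matrix.mulVec, dotProduct, Fintype.sum_prod_type, Fin.sum_univ_three]
      change ∑ j, ((-(a₁ * Q i j) : ℝ) : ℂ) * v (0, j) + ∑ j, ((-(a₂ * Q i j) : ℝ) : ℂ) * v (1, j)
        + ∑ j, ((-(a₃ * Q i j) : ℝ) : ℂ) * v (2, j) = _
      simp [Finset.mul_sum, mul_assoc, sub_eq_add_neg]
    simp only [← h3]
    refine ⟨fun h => ⟨fun i => ?_, fun i => ?_, fun i => congrFun h (2, i)⟩, ?_⟩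
    · rw [← h1, h, Pi.smul_apply, smul_eq_mul]
    · rw [← h2, h, Pi.smul_apply, smul_eq_mul]
    · rintro ⟨e1, e2, e3⟩
      ext ⟨k, i⟩
      fin_cases k
      · exact (h1 i).trans (e1 i)
      · exact (h2 i).trans (e2 i)
      · exact e3 i
  simp only [hrows]
  constructor
  · rintro ⟨v, hv, h1, h2, h3⟩
    refine ⟨fun i => v (0, i), fun h0 => hv ?_, ?_⟩
    · have h0 (i : Fin n) : v (0, i) = 0 := congrFun h0 i
      ext ⟨k, i⟩
      fin_cases k <;> simp [h2, h1, h0]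
    · ext i
      have h := h3 i
      simp only [h2, h1, mul_left_comm _ μ, ← Finset.mul_sum] at h
      simp only [Pi.smul_apply, smul_eq_mul, Matrix.mulVec, dotProduct, Matrix.map_apply]
      linear_combination -h
  · rintro ⟨x, hx, h⟩
    refine ⟨fun p => μ ^ (p.1 : ℕ) * x p.2, fun h0 => hx ?_, ?_, ?_, fun i => ?_⟩
    · ext i
      simpa using congrFun h0 (0, i)
    · simp
    · intro i
      simp
      ring
    · have h := congrFun h i
      simp only [Pi.smul_apply, smul_eq_mul, Matrix.mulVec, dotProduct, Matrix.map_apply] at h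
      simp only [mul_left_comm _ (μ ^ _), ← Finset.mul_sum]
      simp
      linear_combination -h

/-- The spectrum of the third-order block matrix is the union over the eigenvalues `l` of `Q` of
the roots of `z³ + l (a₃ z² + a₂ z + a₁)`. -/
theorem mem_roots_charpoly_thirdOrder_iff_cubic {n : ℕ} (hn : 1 ≤ n)
    {Q : Matrix (Fin n) (Fin n) ℝ} (hQ : Q.IsHermitian) (a₁ a₂ a₃ : ℝ) (μ : ℂ) :
    μ ∈ (((Mblk ![![0, 1, 0], ![0, 0, 1],
        ![-(a₁ • Q), -(a₂ • Q), -(a₃ • Q)]]).map Complex.ofReal).charpoly).roots ↔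
      ∃ i, μ ^ 3 + (hQ.eigenvalues i * a₃ : ℝ) * μ ^ 2 + (hQ.eigenvalues i * a₂ : ℝ) * μ
        + (hQ.eigenvalues i * a₁ : ℝ) = 0 := by
  rw [mem_roots_charpoly_thirdOrder_iff]
  have hchar : (Q.map Complex.ofReal).charpoly =
      ∏ i, (Polynomial.X - Polynomial.C (hQ.eigenvalues i : ℂ)) := by
    refine (Matrix.charpoly_map Q Complex.ofRealHom).trans ?_
    rw [hQ.charpoly_eq]
    simp [Polynomial.map_prod]
  have heig (z : ℂ) : (∃ x : Fin n → ℂ, x ≠ 0 ∧ (Q.map Complex.ofReal).mulVec x = z • x) ↔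
      ∃ i, z = hQ.eigenvalues i := by
    rw [← mem_roots_charpoly_iff_exists_eigenvector,
      Polynomial.mem_roots (Matrix.charpoly_monic _).ne_zero, hchar, Polynomial.IsRoot,
      Polynomial.eval_prod, Finset.prod_eq_zero_iff]
    simp [sub_eq_zero]
  constructor
  · rintro ⟨x, hx, h⟩
    by_cases hp : (a₁ + a₂ * μ + a₃ * μ ^ 2 : ℂ) = 0
    · have hμ : μ ^ 3 = 0 := by
        rw [hp, neg_zero, zero_smul] at h
        exact (smul_eq_zero.mp h).resolve_right hx
      refine ⟨⟨0, hn⟩, ?_⟩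
      push_cast
      linear_combination hμ + (hQ.eigenvalues ⟨0, hn⟩ : ℂ) * hp
    · obtain ⟨i, hi⟩ := (heig (-μ ^ 3 / (a₁ + a₂ * μ + a₃ * μ ^ 2))).mp ⟨x, hx, by
        rw [div_eq_inv_mul, mul_smul, neg_smul, h, neg_smul, neg_neg, inv_smul_smul₀ hp]⟩
      refine ⟨i, ?_⟩
      rw [div_eq_iff hp] at hi
      push_cast
      linear_combination -hi
  · rintro ⟨i, hi⟩
    obtain ⟨x, hx, h⟩ := (heig _).mpr ⟨i, rfl⟩
    refine ⟨x, hx, ?_⟩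
    rw [h, smul_smul]
    congr 1
    push_cast at hi
    linear_combination hi

/-- Third-order stability: the block matrix with rows `(0, I, 0)`, `(0, 0, I)`,
`(-a₁Q, -a₂Q, -a₃Q)` is stable iff `a₁, a₂, a₃ > 0` and `a₂·a₃·λ > a₁` for
every eigenvalue `λ` of `Q`. -/
theorem thirdOrder_stable_iff (n : ℕ) (hn : 1 ≤ n)
    (Q : Matrix (Fin n) (Fin n) ℝ) (hQ : Q.PosDef) (a₁ a₂ a₃ : ℝ) :
    (∀ μ ∈ (((Mblk ![![0, 1, 0], ![0, 0, 1],
        ![-(a₁ • Q), -(a₂ • Q), -(a₃ • Q)]]).map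
        Complex.ofReal).charpoly).roots, μ.re < 0) ↔
      (0 < a₁ ∧ 0 < a₂ ∧ 0 < a₃ ∧
        ∀ lam ∈ Q.charpoly.roots, a₁ < a₂ * a₃ * lam) := by
  have hpos := hQ.eigenvalues_pos
  have hroots (l : ℝ) : l ∈ Q.charpoly.roots ↔ ∃ i, hQ.isHermitian.eigenvalues i = l := by
    simp [hQ.isHermitian.roots_charpoly_eq_eigenvalues]
  have hcubic (i : Fin n) := cubic_roots_re_neg_iff (hQ.isHermitian.eigenvalues i * a₃)
    (hQ.isHermitian.eigenvalues i * a₂) (hQ.isHermitian.eigenvalues i * a₁)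
  have hmul (i : Fin n) : hQ.isHermitian.eigenvalues i * a₁ <
      hQ.isHermitian.eigenvalues i * a₃ * (hQ.isHermitian.eigenvalues i * a₂) ↔
      a₁ < a₂ * a₃ * hQ.isHermitian.eigenvalues i := by
    rw [← mul_lt_mul_iff_right₀ (hpos i) (b := a₁)]
    ring_nf
  simp only [mul_pos_iff_of_pos_left (hpos _), hmul] at hcubic
  simp only [mem_roots_charpoly_thirdOrder_iff_cubic hn hQ.isHermitian, hroots,
    forall_exists_index, forall_apply_eq_imp_iff]
  rw [forall_comm]
  simp only [hcubic]
  constructor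
  · intro h
    obtain ⟨h3, h2, h1, -⟩ := h ⟨0, hn⟩
    exact ⟨h1, h2, h3, fun i => (h i).2.2.2⟩
  · rintro ⟨h1, h2, h3, h⟩ i
    exact ⟨h3, h2, h1, h i⟩
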